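/- Let H_a denote the set of extreme points of P_a, and let G = {{i, j} : i, j ∈ H_a for some a ∈ A, and (R(i) − R(j))·(C(i) − C(j)) ≤ 0}. Then the supremum of the single-type problem equals the maximum, over all nonnegative variables (γ_{ij}, γ_{ji}) for {i,j} ∈ G satisfying Σ_{{i,j}∈G} (γ_{ij}·i + γ_{ji}·j) = θ, of the objective Σ_{{i,j}∈G} [γ_{ij}·R(i)·C(i) + γ_{ji}·R(j)·C(j) − (γ_{ij}·γ_{ji}/(γ_{ij} + γ_{ji}))·(R(i) − R(j))·(C(i) − C(j))] (where a term with γ_{ij} = γ_{ji} = 0 is taken to be 0); moreover this objective is a concave function of the variables γ on the nonnegative orthant. -/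

import Mathlib

open Finset
open scoped Classical

noncomputable section

/-- The probability simplex in `ℝ^n`. -/
def simplex (n : ℕ) : Set (Fin n → ℝ) :=
  {η | (∀ ω, 0 ≤ η ω) ∧ ∑ ω, η ω = 1}

variable {n : ℕ} {A : Type*} [Fintype A] [Nonempty A]

/-- `u*(ω) = max_{a ∈ A} u(ω, a)`. -/
def uStar (u : Fin n → A → ℝ) (ω : Fin n) : ℝ :=
  Finset.univ.sup' Finset.univ_nonempty (u ω)

/-- `C_a(η) = Σ_ω η_ω (u*(ω) − u(ω,a))`, the expected regret of action `a`. -/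
def Ca (u : Fin n → A → ℝ) (a : A) (η : Fin n → ℝ) : ℝ :=
  ∑ ω, η ω * (uStar u ω - u ω a)

/-- The cost of uncertainty `C(η) = min_a C_a(η)`. -/
def Cost (u : Fin n → A → ℝ) (η : Fin n → ℝ) : ℝ :=
  Finset.univ.inf' Finset.univ_nonempty (fun a => Ca u a η)

/-- `P_a`: the polytope of beliefs under which `a` is a best action. -/
def Pa (u : Fin n → A → ℝ) (a : A) : Set (Fin n → ℝ) :=
  {η | η ∈ simplex n ∧ ∀ a' : A, Ca u a η ≤ Ca u a' η}

/-- The likelihood ratio `R(η) = Σ_ω μ_ω η_ω / θ_ω`. -/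
def Ratio (μ θ η : Fin n → ℝ) : ℝ := ∑ ω, μ ω * η ω / θ ω

/-- The set of feasible objective values of the single-type problem. -/
def ConcaveSet (u : Fin n → A → ℝ) (μ θ : Fin n → ℝ) : Set ℝ :=
  {v | ∃ (m : ℕ) (φ : Fin m → ℝ) (η : Fin m → Fin n → ℝ),
    (∀ s, 0 ≤ φ s) ∧ (∀ s, η s ∈ simplex n) ∧
    (∀ ω, ∑ s, φ s * η s ω = θ ω) ∧
    v = ∑ s, φ s * Ratio μ θ (η s) * Cost u (η s)}

/-- A (finitely indexed) family of pairs from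
`G = {{i,j} : i,j extreme points of some P_a, (R(i)−R(j))(C(i)−C(j)) ≤ 0}`. -/
def PairFamily (u : Fin n → A → ℝ) (μ θ : Fin n → ℝ) {m : ℕ}
    (I J : Fin m → Fin n → ℝ) : Prop :=
  ∀ e : Fin m, (∃ a : A, I e ∈ Set.extremePoints ℝ (Pa u a) ∧
      J e ∈ Set.extremePoints ℝ (Pa u a)) ∧
    (Ratio μ θ (I e) - Ratio μ θ (J e)) * (Cost u (I e) - Cost u (J e)) ≤ 0

/-- The objective of the convex program, as a function of the nonnegative
variables `(γ_{ij}, γ_{ji})` (a term with `γ_{ij} = γ_{ji} = 0` is `0`). -/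
def ProgObj (u : Fin n → A → ℝ) (μ θ : Fin n → ℝ) {m : ℕ}
    (I J : Fin m → Fin n → ℝ) (γ : (Fin m → ℝ) × (Fin m → ℝ)) : ℝ :=
  ∑ e, (γ.1 e * Ratio μ θ (I e) * Cost u (I e)
      + γ.2 e * Ratio μ θ (J e) * Cost u (J e)
      - (γ.1 e * γ.2 e / (γ.1 e + γ.2 e)) *
          (Ratio μ θ (I e) - Ratio μ θ (J e)) * (Cost u (I e) - Cost u (J e)))

/-- The set of values of the convex program. -/
def ProgSet (u : Fin n → A → ℝ) (μ θ : Fin n → ℝ) : Set ℝ :=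
  {v | ∃ (m : ℕ) (I J : Fin m → Fin n → ℝ) (γ : (Fin m → ℝ) × (Fin m → ℝ)),
    PairFamily u μ θ I J ∧
    (∀ e, 0 ≤ γ.1 e ∧ 0 ≤ γ.2 e) ∧
    (∀ ω, ∑ e, (γ.1 e * I e ω + γ.2 e * J e ω) = θ ω) ∧
    v = ProgObj u μ θ I J γ}

/-- The convex hull of a compact set in finite dimension is compact. -/
lemma compact_hull_fd {E : Type*} [NormedAddCommGroup E] [NormedSpace ℝ E]
    [FiniteDimensional ℝ E] {K : Set E} (hK : IsCompact K) : IsCompact (convexHull ℝ K) := by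
  have key : convexHull ℝ K = ⋃ k ∈ Finset.range (Module.finrank ℝ E + 2),
      (fun p : (Fin k → ℝ) × (Fin k → E) => ∑ i, p.1 i • p.2 i) ''
        (stdSimplex ℝ (Fin k) ×ˢ Set.pi Set.univ (fun _ => K)) := by
    ext x
    simp only [Set.mem_iUnion, Set.mem_image, Set.mem_prod, Set.mem_pi, Prod.exists]
    constructor
    · intro hx
      obtain ⟨ι, hι, z, w, hz, hai, hw, hw1, hx⟩ := eq_pos_convex_span_of_mem_convexHull hx
      have hc : Fintype.card ι ≤ Module.finrank ℝ E + 1 :=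
        hai.card_le_finrank_succ.trans (by
          gcongr
          exact Submodule.finrank_le _)
      let e := Fintype.equivFin ι
      refine ⟨Fintype.card ι, by simp; omega, w ∘ e.symm, z ∘ e.symm, ⟨⟨fun i => (hw _).le, ?_⟩,
        fun i _ => hz ⟨_, rfl⟩⟩, ?_⟩
      · rw [← hw1]; exact Equiv.sum_comp e.symm w
      · rw [← hx]; exact Equiv.sum_comp e.symm (fun i => w i • z i)
    · rintro ⟨k, -, w, z, ⟨hw, hz⟩, hx⟩
      exact mem_convexHull_of_exists_fintype w z hw.1 hw.2 (fun i => hz i (Set.mem_univ _)) hx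
  rw [key]
  refine Finset.isCompact_biUnion _ fun k _ => ?_
  refine IsCompact.image ((isCompact_stdSimplex ℝ _).prod (isCompact_univ_pi fun _ => hK)) ?_
  fun_prop

lemma Ca_add (u : Fin n → A → ℝ) (a : A) (x y : Fin n → ℝ) :
    Ca u a (x + y) = Ca u a x + Ca u a y := by
  simp [Ca, add_mul, Finset.sum_add_distrib]

lemma Ca_smul (u : Fin n → A → ℝ) (a : A) (c : ℝ) (x : Fin n → ℝ) :
    Ca u a (c • x) = c * Ca u a x := by
  simp [Ca, Finset.mul_sum, mul_assoc]

lemma Ratio_add (μ θ x y : Fin n → ℝ) :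
    Ratio μ θ (x + y) = Ratio μ θ x + Ratio μ θ y := by
  simp [Ratio, mul_add, add_div, Finset.sum_add_distrib]

lemma Ratio_smul (μ θ : Fin n → ℝ) (c : ℝ) (x : Fin n → ℝ) :
    Ratio μ θ (c • x) = c * Ratio μ θ x := by
  simp only [Ratio, Finset.mul_sum, Pi.smul_apply, smul_eq_mul]
  exact Finset.sum_congr rfl fun _ _ => by ring

/-- The ratio as a linear map. -/
def RatioL (μ θ : Fin n → ℝ) : (Fin n → ℝ) →ₗ[ℝ] ℝ where
  toFun := Ratio μ θ
  map_add' := Ratio_add μ θ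
  map_smul' := Ratio_smul μ θ

lemma Ca_cont (u : Fin n → A → ℝ) (a : A) : Continuous (Ca u a) := by
  unfold Ca; fun_prop

lemma Ratio_cont (μ θ : Fin n → ℝ) : Continuous (Ratio μ θ) := by
  unfold Ratio; fun_prop

lemma Cost_cont (u : Fin n → A → ℝ) : Continuous (Cost u) :=
  Continuous.finset_inf'_apply _ fun a _ => Ca_cont u a

lemma simplex_eq : simplex n = stdSimplex ℝ (Fin n) := rfl

lemma Cost_eq {u : Fin n → A → ℝ} {a : A} {η : Fin n → ℝ} (h : η ∈ Pa u a) :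
    Cost u η = Ca u a η :=
  le_antisymm (Finset.inf'_le _ (Finset.mem_univ a)) (Finset.le_inf' _ _ fun b _ => h.2 b)

lemma exists_Pa (u : Fin n → A → ℝ) {η : Fin n → ℝ} (h : η ∈ simplex n) : ∃ a, η ∈ Pa u a := by
  obtain ⟨a, ha⟩ := Finite.exists_min (fun a => Ca u a η)
  exact ⟨a, h, ha⟩

lemma Pa_convex (u : Fin n → A → ℝ) (a : A) : Convex ℝ (Pa u a) := by
  intro x hx y hy p q hp hq hpq
  refine ⟨convex_stdSimplex ℝ (Fin n) hx.1 hy.1 hp hq hpq, fun b => ?_⟩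
  simp only [Ca_add, Ca_smul]
  have := mul_le_mul_of_nonneg_left (hx.2 b) hp
  have := mul_le_mul_of_nonneg_left (hy.2 b) hq
  linarith

lemma Pa_compact (u : Fin n → A → ℝ) (a : A) : IsCompact (Pa u a) := by
  have : Pa u a = stdSimplex ℝ (Fin n) ∩ ⋂ b, {η | Ca u a η ≤ Ca u b η} := by
    ext η; simp [Pa, simplex_eq]
  rw [this]
  exact (isCompact_stdSimplex ℝ _).inter_right
    (isClosed_iInter fun b => isClosed_le (Ca_cont u a) (Ca_cont u b))

lemma small_eps {ι : Type*} [Fintype ι] (s d : ι → ℝ) (hs : ∀ i, 0 ≤ s i)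
    (h : ∀ i, s i = 0 → d i = 0) :
    ∃ ε > 0, ∀ i, 0 ≤ s i + ε * d i ∧ 0 ≤ s i - ε * d i := by
  have : ∀ i, ∃ ε > 0, ∀ e, 0 ≤ e → e ≤ ε → 0 ≤ s i + e * d i ∧ 0 ≤ s i - e * d i := by
    intro i
    rcases (hs i).eq_or_lt with h0 | h0
    · refine ⟨1, one_pos, fun e _ _ => ?_⟩
      rw [h i h0.symm, ← h0]; simp
    · refine ⟨s i / (|d i| + 1), by positivity, fun e he hle => ?_⟩
      rw [le_div_iff₀ (by positivity)] at hle
      have h1 := abs_le.mp (le_of_eq (abs_mul e (d i)))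
      have h2 : e * |d i| ≤ s i := by nlinarith
      rw [abs_of_nonneg he] at h1
      constructor <;> linarith [h1.1, h1.2]
  choose f hf hf2 using this
  rcases isEmpty_or_nonempty ι with hι | hι
  · exact ⟨1, one_pos, fun i => hι.elim i⟩
  · obtain ⟨i0, hi0⟩ := Finite.exists_min f
    exact ⟨f i0, hf i0, fun i => hf2 i _ (hf i0).le (hi0 i)⟩

lemma ext_finite (u : Fin n → A → ℝ) (a : A) : (Set.extremePoints ℝ (Pa u a)).Finite := by
  let T : (Fin n → ℝ) → Set (Fin n) × Set A :=
    fun η => ({ω | η ω = 0}, {b | Ca u b η - Ca u a η = 0})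
  refine Set.Finite.of_injOn (f := T) (t := Set.univ) (fun _ _ => Set.mem_univ _) ?_
    Set.finite_univ
  intro x hx y hy hxy
  have hT1 : ∀ ω, x ω = 0 → y ω = 0 := fun ω h =>
    (Set.ext_iff.mp (congrArg Prod.fst hxy) ω).mp h
  have hT2 : ∀ b, Ca u b x - Ca u a x = 0 → Ca u b y - Ca u a y = 0 := fun b h =>
    (Set.ext_iff.mp (congrArg Prod.snd hxy) b).mp h
  obtain ⟨ε, hε, h1⟩ := small_eps (ι := Fin n ⊕ A)
    (Sum.elim x (fun b => Ca u b x - Ca u a x))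
    (Sum.elim (fun ω => y ω - x ω)
      (fun b => (Ca u b y - Ca u a y) - (Ca u b x - Ca u a x)))
    (by
      rintro (ω | b)
      · exact hx.1.1.1 ω
      · simpa using hx.1.2 b)
    (by
      rintro (ω | b) h
      · simp only [Sum.elim_inl] at h ⊢; rw [h, hT1 ω h]; simp
      · simp only [Sum.elim_inr] at h ⊢; rw [h, hT2 b h]; simp)
  have hsub : ∀ b, Ca u b (y - x) = Ca u b y - Ca u b x := by
    intro b
    have := Ca_add u b (y - x) x
    rw [sub_add_cancel] at this; linarith
  have mem : ∀ e : ℝ, (e = ε ∨ e = -ε) → x + e • (y - x) ∈ Pa u a := by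
    intro e he
    refine ⟨⟨fun ω => ?_, ?_⟩, fun b => ?_⟩
    · have := h1 (Sum.inl ω)
      simp only [Sum.elim_inl] at this
      simp only [Pi.add_apply, Pi.smul_apply, Pi.sub_apply, smul_eq_mul]
      rcases he with rfl | rfl
      · exact this.1
      · linarith [this.2]
    · simp only [Pi.add_apply, Pi.smul_apply, Pi.sub_apply, smul_eq_mul,
        Finset.sum_add_distrib, ← Finset.mul_sum, Finset.sum_sub_distrib]
      rw [hx.1.1.2, hy.1.1.2]; ring
    · have := h1 (Sum.inr b)
      simp only [Sum.elim_inr] at this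
      simp only [Ca_add, Ca_smul, hsub]
      rcases he with rfl | rfl
      · nlinarith [this.1]
      · nlinarith [this.2]
  have := hx.2 (mem ε (Or.inl rfl)) (mem (-ε) (Or.inr rfl))
    ⟨1/2, 1/2, by norm_num, by norm_num, by norm_num, by
      ext ω; simp only [Pi.add_apply, Pi.smul_apply, Pi.sub_apply, smul_eq_mul]; ring⟩
  ext ω
  have h2 := congrFun this ω
  simp only [Pi.add_apply, Pi.smul_apply, Pi.sub_apply, smul_eq_mul] at h2
  have h3 : ε * (y ω - x ω) = 0 := by linarith
  rcases mul_eq_zero.mp h3 with h | h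
  · exact absurd h hε.ne'
  · linarith

lemma Pa_hull (u : Fin n → A → ℝ) (a : A) :
    convexHull ℝ (Set.extremePoints ℝ (Pa u a)) = Pa u a := by
  rw [← closure_convexHull_extremePoints (Pa_compact u a) (Pa_convex u a),
    ((ext_finite u a).isClosed_convexHull ℝ).closure_eq]
  congr 2
  rw [← ((ext_finite u a).isClosed_convexHull ℝ).closure_eq,
    closure_convexHull_extremePoints (Pa_compact u a) (Pa_convex u a)]

/-- One summand of the program's objective. -/
def term (u : Fin n → A → ℝ) (μ θ : Fin n → ℝ) (i j : Fin n → ℝ) (p q : ℝ) : ℝ :=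
  p * Ratio μ θ i * Cost u i + q * Ratio μ θ j * Cost u j
      - (p * q / (p + q)) * (Ratio μ θ i - Ratio μ θ j) * (Cost u i - Cost u j)

/-- Admissible pairs. -/
def IsPair (u : Fin n → A → ℝ) (μ θ : Fin n → ℝ) (i j : Fin n → ℝ) : Prop :=
  (∃ a : A, i ∈ Set.extremePoints ℝ (Pa u a) ∧ j ∈ Set.extremePoints ℝ (Pa u a)) ∧
    (Ratio μ θ i - Ratio μ θ j) * (Cost u i - Cost u j) ≤ 0

/-- Generators: points carried by one pair, with a value below the pair's summand. -/
def Gens (u : Fin n → A → ℝ) (μ θ : Fin n → ℝ) : Set ((Fin n → ℝ) × ℝ) :=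
  {x | ∃ i j p q, IsPair u μ θ i j ∧ 0 ≤ p ∧ 0 ≤ q ∧ p • i + q • j = x.1 ∧
    x.2 ≤ term u μ θ i j p q}

/-- On a pair inside `P_a`, a summand is the value of the mixed posterior. -/
lemma term_eq {u : Fin n → A → ℝ} {μ θ : Fin n → ℝ} {a : A} {i j : Fin n → ℝ}
    (hi : i ∈ Pa u a) (hj : j ∈ Pa u a) {c p q : ℝ} (hp : 0 ≤ p) (hq : 0 ≤ q) (hpq : p + q = 1) :
    term u μ θ i j (c * p) (c * q) =
      c * (Ratio μ θ (p • i + q • j) * Cost u (p • i + q • j)) := by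
  rw [Cost_eq (Pa_convex u a hi hj hp hq hpq), Ca_add, Ca_smul, Ca_smul, Ratio_add, Ratio_smul,
    Ratio_smul]
  unfold term
  rw [Cost_eq hi, Cost_eq hj]
  have : c * p * (c * q) / (c * p + c * q) = c * p * q := by
    rw [← mul_add, hpq]
    by_cases hc : c = 0
    · simp [hc]
    · field_simp
  rw [this]
  obtain rfl : q = 1 - p := by linarith
  ring

lemma step_lemma {E : Type*} (t : Finset E) (w δ : E → ℝ) (hw : ∀ k ∈ t, 0 < w k)
    (h0 : ∑ k ∈ t, δ k = 0) (hδ : ∃ k ∈ t, δ k ≠ 0) :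
    ∃ τ > 0, (∀ k ∈ t, 0 ≤ w k + τ * δ k) ∧ ∃ k ∈ t, w k + τ * δ k = 0 := by
  have hneg : (t.filter (fun k => δ k < 0)).Nonempty := by
    by_contra hne
    rw [Finset.not_nonempty_iff_eq_empty, Finset.filter_eq_empty_iff] at hne
    obtain ⟨k, hk, hk0⟩ := hδ
    exact hk0 ((Finset.sum_eq_zero_iff_of_nonneg fun k hk => not_lt.mp (hne hk)).mp h0 k hk)
  obtain ⟨k0, hk0, hmin⟩ := Finset.exists_min_image _ (fun k => w k / (-δ k)) hneg
  rw [Finset.mem_filter] at hk0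
  have hτ : 0 < w k0 / (-δ k0) := div_pos (hw _ hk0.1) (by linarith [hk0.2])
  refine ⟨w k0 / (-δ k0), hτ, fun k hk => ?_, k0, hk0.1, ?_⟩
  · rcases lt_or_ge (δ k) 0 with h | h
    · have := hmin k (Finset.mem_filter.mpr ⟨hk, h⟩)
      rw [le_div_iff₀ (by linarith)] at this
      linarith
    · have := mul_nonneg hτ.le h
      linarith [hw k hk]
  · have := hk0.2.ne
    rw [div_mul_eq_mul_div, div_neg, mul_div_cancel_right₀ _ this]; ring

lemma exists_dir {E : Type*} (t : Finset E) (r : E → ℝ) (ht : 2 < t.card) :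
    ∃ δ : E → ℝ, ∑ k ∈ t, δ k = 0 ∧ ∑ k ∈ t, δ k * r k = 0 ∧ ∃ k ∈ t, δ k ≠ 0 := by
  have hli : ¬ LinearIndependent ℝ (fun k : t => ((1 : ℝ), r k)) := by
    intro h
    have := h.fintype_card_le_finrank
    simp at this
    omega
  obtain ⟨g, hg, k, hk⟩ := Fintype.not_linearIndependent_iff.mp hli
  have h1 := congrArg Prod.fst hg
  have h2 := congrArg Prod.snd hg
  simp only [Prod.fst_sum, Prod.snd_sum, Prod.smul_fst, Prod.smul_snd, smul_eq_mul, mul_one,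
    Prod.fst_zero, Prod.snd_zero] at h1 h2
  refine ⟨fun x => if hx : x ∈ t then g ⟨x, hx⟩ else 0, ?_, ?_, k, k.2, by simpa using hk⟩
  · rw [← Finset.sum_coe_sort]; simpa using h1
  · rw [← Finset.sum_coe_sort]; simpa using h2

lemma base_case (u : Fin n → A → ℝ) (μ θ : Fin n → ℝ) {a : A} {i j : Fin n → ℝ}
    (hi : i ∈ Set.extremePoints ℝ (Pa u a)) (hj : j ∈ Set.extremePoints ℝ (Pa u a))
    {η : Fin n → ℝ} (hη : η ∈ segment ℝ i j) {c : ℝ} (hc : 0 ≤ c) :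
    (c • η, c * (Ratio μ θ η * Cost u η)) ∈ AddSubmonoid.closure (Gens u μ θ) := by
  obtain ⟨p, q, hp, hq, hpq, rfl⟩ := hη
  have hval := term_eq (μ := μ) (θ := θ) (c := c) hi.1 hj.1 hp hq hpq
  by_cases h : (Ratio μ θ i - Ratio μ θ j) * (Cost u i - Cost u j) ≤ 0
  · apply AddSubmonoid.subset_closure
    refine ⟨i, j, c * p, c * q, ⟨⟨a, hi, hj⟩, h⟩, by positivity, by positivity, ?_, hval.ge⟩
    simp [smul_smul]
  · have hs : (c • (p • i + q • j), c * (Ratio μ θ (p • i + q • j) * Cost u (p • i + q • j))) =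
        ((c * p) • i, c * p * Ratio μ θ i * Cost u i) + ((c * q) • j,
          c * (Ratio μ θ (p • i + q • j) * Cost u (p • i + q • j))
            - c * p * Ratio μ θ i * Cost u i) := by
      ext <;> simp [mul_assoc, mul_add]
    rw [hs]
    refine add_mem (AddSubmonoid.subset_closure ?_) (AddSubmonoid.subset_closure ?_)
    · exact ⟨i, i, c * p, 0, ⟨⟨a, hi, hi⟩, by simp⟩, by positivity, le_rfl, by simp,
        by simp [term]⟩
    · refine ⟨j, j, c * q, 0, ⟨⟨a, hj, hj⟩, by simp⟩, by positivity, le_rfl, by simp, ?_⟩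
      simp only [term, sub_self, mul_zero, zero_mul, add_zero, sub_zero]
      rw [← hval]
      unfold term
      have h2 : 0 ≤ c * p * (c * q) / (c * p + c * q) := by positivity
      have := mul_nonneg h2 (not_le.mp h).le
      rw [← mul_assoc] at this
      linarith

lemma main_red (u : Fin n → A → ℝ) (μ θ : Fin n → ℝ) (a : A) (N : ℕ) :
    ∀ t : Finset (Fin n → ℝ), t.card ≤ N → (t : Set (Fin n → ℝ)) ⊆ Set.extremePoints ℝ (Pa u a) →
    ∀ η ∈ convexHull ℝ (t : Set (Fin n → ℝ)), ∀ c : ℝ, 0 ≤ c →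
    (c • η, c * (Ratio μ θ η * Cost u η)) ∈ AddSubmonoid.closure (Gens u μ θ) := by
  induction N with
  | zero =>
    intro t ht _ η hη
    obtain rfl : t = ∅ := by simpa using ht
    simp at hη
  | succ N ih =>
    intro t ht hsub η hη c hc
    by_cases h3 : 2 < t.card
    swap
    · have h12 : t.card = 0 ∨ t.card = 1 ∨ t.card = 2 := by omega
      rcases h12 with h | h | h
      · obtain rfl : t = ∅ := by simpa using h
        simp at hη
      · obtain ⟨i, rfl⟩ := Finset.card_eq_one.mp h
        have hi : i ∈ Set.extremePoints ℝ (Pa u a) := hsub (by simp)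
        refine base_case u μ θ hi hi ?_ hc
        simpa using hη
      · obtain ⟨i, j, -, rfl⟩ := Finset.card_eq_two.mp h
        refine base_case u μ θ (hsub (a := i) (by simp)) (hsub (a := j) (by simp)) ?_ hc
        simpa [convexHull_pair] using hη
    · have hera : ∀ k ∈ t, ∀ w : (Fin n → ℝ) → ℝ, (∀ x ∈ t, 0 ≤ w x) → ∑ x ∈ t, w x = 1 →
          w k = 0 → ∀ d : ℝ, 0 ≤ d →
          (d • (∑ x ∈ t, w x • x), d * (Ratio μ θ (∑ x ∈ t, w x • x) *
            Cost u (∑ x ∈ t, w x • x))) ∈ AddSubmonoid.closure (Gens u μ θ) := by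
        intro k hk w hw hw1 hk0 d hd
        refine ih (t.erase k) (by rw [Finset.card_erase_of_mem hk]; omega)
          (fun x hx => hsub (Finset.mem_of_mem_erase hx)) _ ?_ d hd
        rw [Finset.mem_convexHull']
        refine ⟨w, fun x hx => hw x (Finset.mem_of_mem_erase hx), ?_, ?_⟩
        · rw [← hw1, Finset.sum_erase _ hk0]
        · rw [Finset.sum_erase]; simp [hk0]
      have hmemPa : ∀ w : (Fin n → ℝ) → ℝ, (∀ x ∈ t, 0 ≤ w x) → ∑ x ∈ t, w x = 1 →
          ∑ x ∈ t, w x • x ∈ Pa u a := fun w hw hw1 =>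
        (Pa_convex u a).sum_mem hw hw1 fun x hx => (hsub hx).1
      obtain ⟨w, hw, hw1, rfl⟩ := Finset.mem_convexHull'.mp hη
      by_cases hz : ∃ k ∈ t, w k = 0
      · obtain ⟨k, hk, hk0⟩ := hz
        exact hera k hk w hw hw1 hk0 c hc
      push Not at hz
      have hwpos : ∀ k ∈ t, 0 < w k := fun k hk => (hw k hk).lt_of_ne' (hz k hk)
      obtain ⟨δ, hδ0, hδr, hδn⟩ := exists_dir t (Ratio μ θ) h3
      obtain ⟨s, hs, hs1, k1, hk1, hs2⟩ := step_lemma t w δ hwpos hδ0 hδn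
      obtain ⟨r, hr, hr1, k2, hk2, hr2⟩ := step_lemma t w (fun k => - δ k) hwpos
        (by simp [hδ0]) (by simpa using hδn)
      set D : Fin n → ℝ := ∑ x ∈ t, δ x • x with hD
      set η : Fin n → ℝ := ∑ x ∈ t, w x • x with hηd
      have e1 : ∑ x ∈ t, (w x + s * δ x) • x = η + s • D := by
        simp [hD, hηd, add_smul, Finset.sum_add_distrib, Finset.smul_sum, smul_smul]
      have e2 : ∑ x ∈ t, (w x + r * -δ x) • x = η + (-r) • D := by
        simp [hD, hηd, add_smul, Finset.sum_add_distrib, Finset.smul_sum, smul_smul]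
      have f1 : ∑ x ∈ t, (w x + s * δ x) = 1 := by
        rw [Finset.sum_add_distrib, ← Finset.mul_sum, hδ0, hw1]; simp
      have f2 : ∑ x ∈ t, (w x + r * -δ x) = 1 := by
        rw [Finset.sum_add_distrib, ← Finset.mul_sum, Finset.sum_neg_distrib, hδ0, hw1]; simp
      have g1 := hera k1 hk1 (fun x => w x + s * δ x) hs1 f1 hs2 (c * (r / (s + r)))
        (by positivity)
      have g2 := hera k2 hk2 (fun x => w x + r * -δ x) hr1 f2 hr2 (c * (s / (s + r)))
        (by positivity)
      have p0 := hmemPa w hw hw1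
      have p1 := hmemPa (fun x => w x + s * δ x) hs1 f1
      have p2 := hmemPa (fun x => w x + r * -δ x) hr1 f2
      simp only [e1, e2] at g1 g2 p1 p2
      have hRD : Ratio μ θ D = 0 := by
        have : RatioL μ θ D = 0 := by
          rw [hD, map_sum]
          simp only [map_smul, smul_eq_mul]
          exact hδr
        exact this
      rw [Cost_eq p1, Ca_add, Ca_smul, Ratio_add, Ratio_smul, hRD] at g1
      rw [Cost_eq p2, Ca_add, Ca_smul, Ratio_add, Ratio_smul, hRD] at g2
      rw [Cost_eq p0]
      convert add_mem g1 g2 using 1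
      have hsr : s + r ≠ 0 := by positivity
      refine Prod.ext ?_ ?_
      · ext ω
        simp only [Prod.mk_add_mk, Pi.add_apply, Pi.smul_apply, smul_eq_mul]
        field_simp
        ring
      · simp only [Prod.mk_add_mk]
        field_simp
        ring

lemma mem_cone (u : Fin n → A → ℝ) (μ θ : Fin n → ℝ) {η : Fin n → ℝ} (hη : η ∈ simplex n)
    {c : ℝ} (hc : 0 ≤ c) :
    (c • η, c * (Ratio μ θ η * Cost u η)) ∈ AddSubmonoid.closure (Gens u μ θ) := by
  obtain ⟨a, ha⟩ := exists_Pa u hη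
  refine main_red u μ θ a _ (ext_finite u a).toFinset le_rfl (by simp) η ?_ c hc
  rw [Set.Finite.coe_toFinset, Pa_hull]
  exact ha

lemma list_prog (u : Fin n → A → ℝ) (μ θ : Fin n → ℝ) (x : (Fin n → ℝ) × ℝ)
    (hx : x ∈ AddSubmonoid.closure (Gens u μ θ)) :
    ∃ (m : ℕ) (I J : Fin m → Fin n → ℝ) (γ : (Fin m → ℝ) × (Fin m → ℝ)),
    PairFamily u μ θ I J ∧ (∀ e, 0 ≤ γ.1 e ∧ 0 ≤ γ.2 e) ∧
    (∀ ω, ∑ e, (γ.1 e * I e ω + γ.2 e * J e ω) = x.1 ω) ∧ x.2 ≤ ProgObj u μ θ I J γ := by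
  obtain ⟨l, hl, rfl⟩ := AddSubmonoid.exists_list_of_mem_closure hx
  have h := fun e : Fin l.length => hl (l.get e) (List.get_mem l e)
  choose I J p q hI hp hq hs hv using h
  have hsum : l.sum = ∑ e : Fin l.length, l.get e := by
    rw [← List.sum_ofFn, List.ofFn_get]
  refine ⟨l.length, I, J, (p, q), hI, fun e => ⟨hp e, hq e⟩, fun ω => ?_, ?_⟩
  · rw [hsum, Prod.fst_sum, Finset.sum_apply]
    refine Finset.sum_congr rfl fun e _ => ?_
    rw [← hs e]; rfl
  · rw [hsum, Prod.snd_sum]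
    exact Finset.sum_le_sum fun e _ => hv e

lemma concave_le_prog (u : Fin n → A → ℝ) (μ θ : Fin n → ℝ) {v : ℝ}
    (hv : v ∈ ConcaveSet u μ θ) : ∃ v' ∈ ProgSet u μ θ, v ≤ v' := by
  obtain ⟨m, φ, η, hφ, hη, hs, rfl⟩ := hv
  have := sum_mem (t := Finset.univ) fun s _ => mem_cone u μ θ (hη s) (hφ s)
  obtain ⟨k, I, J, γ, h1, h2, h3, h4⟩ := list_prog u μ θ _ this
  refine ⟨_, ⟨k, I, J, γ, h1, h2, fun ω => ?_, rfl⟩, ?_⟩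
  · rw [h3, ← hs, Prod.fst_sum, Finset.sum_apply]; rfl
  · rw [Prod.snd_sum] at h4
    simpa only [mul_assoc] using h4

lemma prog_sub (u : Fin n → A → ℝ) (μ θ : Fin n → ℝ) :
    ProgSet u μ θ ⊆ ConcaveSet u μ θ := by
  rintro v ⟨m, I, J, γ, hP, hγ, hs, rfl⟩
  have key : ∀ e, ∃ c : ℝ, ∃ η ∈ simplex n, 0 ≤ c ∧ c • η = γ.1 e • I e + γ.2 e • J e ∧
      term u μ θ (I e) (J e) (γ.1 e) (γ.2 e) = c * (Ratio μ θ η * Cost u η) := by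
    intro e
    obtain ⟨⟨a, hi, hj⟩, -⟩ := hP e
    obtain ⟨h1, h2⟩ := hγ e
    by_cases h0 : γ.1 e + γ.2 e = 0
    · have ha : γ.1 e = 0 := by linarith
      have hb : γ.2 e = 0 := by linarith
      exact ⟨0, I e, hi.1.1, le_rfl, by simp [ha, hb], by simp [term, ha, hb]⟩
    · have hp : 0 ≤ γ.1 e / (γ.1 e + γ.2 e) := by positivity
      have hq : 0 ≤ γ.2 e / (γ.1 e + γ.2 e) := by positivity
      have hpq : γ.1 e / (γ.1 e + γ.2 e) + γ.2 e / (γ.1 e + γ.2 e) = 1 := by field_simp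
      refine ⟨γ.1 e + γ.2 e, _, (Pa_convex u a hi.1 hj.1 hp hq hpq).1, by positivity, ?_, ?_⟩
      · rw [smul_add, smul_smul, smul_smul, mul_div_cancel₀ _ h0, mul_div_cancel₀ _ h0]
      · rw [← term_eq hi.1 hj.1 hp hq hpq, mul_div_cancel₀ _ h0, mul_div_cancel₀ _ h0]
  choose c η hη hc hcs hct using key
  refine ⟨m, c, η, hc, hη, fun ω => ?_, ?_⟩
  · rw [← hs]
    refine Finset.sum_congr rfl fun e _ => ?_
    exact congrFun (hcs e) ω
  · refine Finset.sum_congr rfl fun e _ => ?_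
    rw [mul_assoc (c e), ← hct]; rfl

lemma concaveSet_eq (u : Fin n → A → ℝ) (μ θ : Fin n → ℝ) (hθ : θ ∈ simplex n) :
    ConcaveSet u μ θ = (fun v => (θ, v)) ⁻¹' convexHull ℝ
      ((fun η => (η, Ratio μ θ η * Cost u η)) '' stdSimplex ℝ (Fin n)) := by
  ext v
  rw [Set.mem_preimage]
  constructor
  · rintro ⟨m, φ, η, hφ, hη, hs, rfl⟩
    refine mem_convexHull_of_exists_fintype φ (fun s => (η s, Ratio μ θ (η s) * Cost u (η s)))
      hφ ?_ (fun s => ⟨η s, hη s, rfl⟩) ?_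
    · rw [← hθ.2]
      simp_rw [← hs]
      rw [Finset.sum_comm]
      refine Finset.sum_congr rfl fun s _ => ?_
      rw [← Finset.mul_sum, (hη s).2, mul_one]
    · refine Prod.ext ?_ ?_
      · ext ω
        rw [Prod.fst_sum, Finset.sum_apply]; exact hs ω
      · rw [Prod.snd_sum]
        simp [mul_assoc]
  · intro h
    rw [mem_convexHull_iff_exists_fintype] at h
    obtain ⟨ι, _, w, z, hw, hw1, hz, hx⟩ := h
    choose η hη hηz using hz
    let e := Fintype.equivFin ι
    refine ⟨Fintype.card ι, w ∘ e.symm, η ∘ e.symm, fun s => hw _, fun s => hη _, fun ω => ?_, ?_⟩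
    · have := congrFun (congrArg Prod.fst hx) ω
      simp only [← hηz, Prod.fst_sum, Finset.sum_apply, Prod.smul_fst, Pi.smul_apply,
        smul_eq_mul] at this
      rw [← this]
      exact Equiv.sum_comp e.symm (fun i => w i * η i ω)
    · have := congrArg Prod.snd hx
      simp only [← hηz, Prod.snd_sum, Prod.smul_snd, smul_eq_mul] at this
      rw [← this]
      simp only [mul_assoc]
      exact (Equiv.sum_comp e.symm (fun i => w i * (Ratio μ θ (η i) * Cost u (η i)))).symm

lemma concaveSet_compact (u : Fin n → A → ℝ) (μ θ : Fin n → ℝ) (hθ : θ ∈ simplex n) :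
    IsCompact (ConcaveSet u μ θ) := by
  have hK : IsCompact (convexHull ℝ
      ((fun η => (η, Ratio μ θ η * Cost u η)) '' stdSimplex ℝ (Fin n))) := by
    refine compact_hull_fd ((isCompact_stdSimplex ℝ _).image ?_)
    exact continuous_id.prodMk ((Ratio_cont μ θ).mul (Cost_cont u))
  have hc : IsClosed (ConcaveSet u μ θ) := by
    rw [concaveSet_eq u μ θ hθ]
    exact hK.isClosed.preimage (by fun_prop)
  refine (hK.image continuous_snd).of_isClosed_subset hc ?_
  rw [concaveSet_eq u μ θ hθ]
  intro v hv
  exact ⟨_, hv, rfl⟩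

lemma concaveSet_nonempty (u : Fin n → A → ℝ) (μ θ : Fin n → ℝ) (hθ : θ ∈ simplex n) :
    (ConcaveSet u μ θ).Nonempty :=
  ⟨_, 1, fun _ => 1, fun _ => θ, fun _ => zero_le_one, fun _ => hθ, fun ω => by simp, rfl⟩

lemma harm_super {x y z w : ℝ} (hx : 0 ≤ x) (hy : 0 ≤ y) (hz : 0 ≤ z) (hw : 0 ≤ w) :
    x * y / (x + y) + z * w / (z + w) ≤ (x + z) * (y + w) / ((x + z) + (y + w)) := by
  rcases (add_nonneg hx hy).eq_or_lt with h | h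
  · have h1 : x = 0 := by linarith
    have h2 : y = 0 := by linarith
    simp [h1, h2]
  rcases (add_nonneg hz hw).eq_or_lt with h' | h'
  · have h1 : z = 0 := by linarith
    have h2 : w = 0 := by linarith
    simp [h1, h2]
  have : (x + z) * (y + w) / ((x + z) + (y + w)) - (x * y / (x + y) + z * w / (z + w)) =
      (x * w - z * y) ^ 2 / ((x + y) * (z + w) * ((x + z) + (y + w))) := by
    have h3 : (x + z) + (y + w) ≠ 0 := (by linarith : 0 < (x + z) + (y + w)).ne'
    field_simp
    ring
  have h4 : 0 ≤ (x * w - z * y) ^ 2 / ((x + y) * (z + w) * ((x + z) + (y + w))) := by positivity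
  linarith

lemma harm_smul (c x y : ℝ) : c * x * (c * y) / (c * x + c * y) = c * (x * y / (x + y)) := by
  by_cases hc : c = 0
  · simp [hc]
  · rw [← mul_add, mul_assoc, mul_div_mul_left _ _ hc]; ring

lemma prog_concave (u : Fin n → A → ℝ) (μ θ : Fin n → ℝ) (m : ℕ) (I J : Fin m → Fin n → ℝ)
    (hP : PairFamily u μ θ I J) :
    ConcaveOn ℝ {γ : (Fin m → ℝ) × (Fin m → ℝ) | ∀ e, 0 ≤ γ.1 e ∧ 0 ≤ γ.2 e}
        (ProgObj u μ θ I J) := by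
  constructor
  · intro x hx y hy p q hp hq _ e
    have h1 := hx e
    have h2 := hy e
    simp only [Prod.fst_add, Prod.snd_add, Prod.smul_fst, Prod.smul_snd, Pi.add_apply,
      Pi.smul_apply, smul_eq_mul]
    exact ⟨add_nonneg (mul_nonneg hp h1.1) (mul_nonneg hq h2.1),
      add_nonneg (mul_nonneg hp h1.2) (mul_nonneg hq h2.2)⟩
  · intro x hx y hy p q hp hq _
    unfold ProgObj
    rw [smul_eq_mul, smul_eq_mul, Finset.mul_sum, Finset.mul_sum, ← Finset.sum_add_distrib]
    refine Finset.sum_le_sum fun e _ => ?_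
    obtain ⟨a1, a2⟩ := hx e
    obtain ⟨b1, b2⟩ := hy e
    simp only [Prod.fst_add, Prod.snd_add, Prod.smul_fst, Prod.smul_snd, Pi.add_apply,
      Pi.smul_apply, smul_eq_mul]
    have h := harm_super (mul_nonneg hp a1) (mul_nonneg hp a2) (mul_nonneg hq b1)
      (mul_nonneg hq b2)
    rw [harm_smul, harm_smul] at h
    have h2 := mul_le_mul_of_nonpos_right h (hP e).2
    set X := (p * x.1 e + q * y.1 e) * (p * x.2 e + q * y.2 e) /
      (p * x.1 e + q * y.1 e + (p * x.2 e + q * y.2 e))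
    set Y := x.1 e * x.2 e / (x.1 e + x.2 e)
    set Z := y.1 e * y.2 e / (y.1 e + y.2 e)
    linarith


/-- the supremum of the single-type problem equals the maximum of the
convex program over pairs of extreme points from `G`, and the program's objective is a
concave function of the variables `γ` on the nonnegative orthant. -/
theorem stmt10 (hn : 1 ≤ n) (u : Fin n → A → ℝ)
    (μ θ : Fin n → ℝ) (hμ : μ ∈ simplex n) (hθ : θ ∈ simplex n)
    (hθpos : ∀ ω, 0 < θ ω) :
    sSup (ConcaveSet u μ θ) = sSup (ProgSet u μ θ) ∧
    sSup (ProgSet u μ θ) ∈ ProgSet u μ θ ∧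
    (∀ (m : ℕ) (I J : Fin m → Fin n → ℝ), PairFamily u μ θ I J →
      ConcaveOn ℝ {γ : (Fin m → ℝ) × (Fin m → ℝ) | ∀ e, 0 ≤ γ.1 e ∧ 0 ≤ γ.2 e}
        (ProgObj u μ θ I J)) := by
  have hc := concaveSet_compact u μ θ hθ
  have hne := concaveSet_nonempty u μ θ hθ
  have hmem := hc.sSup_mem hne
  obtain ⟨v, hv, hle⟩ := concave_le_prog u μ θ hmem
  have hg : IsGreatest (ProgSet u μ θ) (sSup (ConcaveSet u μ θ)) := by
    have hub : ∀ x ∈ ConcaveSet u μ θ, x ≤ sSup (ConcaveSet u μ θ) :=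
      fun x hx => le_csSup hc.bddAbove hx
    have : v = sSup (ConcaveSet u μ θ) := le_antisymm (hub v (prog_sub u μ θ hv)) hle
    exact ⟨this ▸ hv, fun x hx => hub x (prog_sub u μ θ hx)⟩
  have heq := hg.csSup_eq
  exact ⟨heq.symm, heq.symm ▸ hg.1, prog_concave u μ θ⟩

end
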